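/- For d ≥ 2, κ_i ≥ 0 (i = 1,…,d+1), n ∈ ℕ_0 and 1 ≤ ℓ ≤ d: every polynomial f in d variables of degree at most n satisfies ‖ (√x_ℓ/√(1−x_ℓ)) (⟨x,∇⟩ − ∂_ℓ) f ‖_{κ,2} ≤ √(n(n+|κ|+d)) ‖f‖_{κ,2}, and this inequality is sharp: there exists a nonzero polynomial f of degree exactly n for which equality holds. -/

import Mathlib

open MeasureTheory Finset

noncomputable section

/-- The simplex `△^d = {x : x_i ≥ 0, x_1 + ⋯ + x_d ≤ 1}`. -/
def Splx (d : ℕ) : Set (Fin d → ℝ) := {x | (∀ i, 0 ≤ x i) ∧ ∑ i, x i ≤ 1}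

/-- The `i`-th partial derivative. -/
def pd {d : ℕ} (i : Fin d) (f : (Fin d → ℝ) → ℝ) : (Fin d → ℝ) → ℝ :=
  fun x => fderiv ℝ f x (Pi.single i 1)

/-- `∂_{i,j} = ∂_i - ∂_j`. -/
def pdd {d : ℕ} (i j : Fin d) (f : (Fin d → ℝ) → ℝ) : (Fin d → ℝ) → ℝ :=
  fun x => pd i f x - pd j f x

/-- `⟨x,∇⟩ = ∑ x_i ∂_i`. -/
def xgrad {d : ℕ} (f : (Fin d → ℝ) → ℝ) : (Fin d → ℝ) → ℝ :=
  fun x => ∑ i, x i * pd i f x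

/-- The Jacobi weight `W_κ(x) = x_1^{κ_1} ⋯ x_d^{κ_d} (1-|x|)^{κ_{d+1}}`. -/
def Wk {d : ℕ} (κ : Fin (d+1) → ℝ) (x : Fin d → ℝ) : ℝ :=
  (∏ i : Fin d, x i ^ κ i.castSucc) * (1 - ∑ i, x i) ^ κ (Fin.last d)

/-- The spectral operator `D_κ`. -/
def Dk {d : ℕ} (κ : Fin (d+1) → ℝ) (f : (Fin d → ℝ) → ℝ) (x : Fin d → ℝ) : ℝ :=
  (∑ i, x i * (1 - x i) * pd i (pd i f) x)
    - 2 * ∑ i, ∑ j ∈ Finset.univ.filter (fun j => i < j), x i * x j * pd i (pd j f) x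
    + ∑ i, (κ i.castSucc + 1 - ((∑ k, κ k) + (d : ℝ) + 1) * x i) * pd i f x

/-- The normalizing constant `b_κ`. -/
def bk {d : ℕ} (κ : Fin (d+1) → ℝ) : ℝ :=
  Real.Gamma ((∑ i, κ i) + (d : ℝ) + 1) / ∏ i, Real.Gamma (κ i + 1)

/-- The inner product `⟨f,g⟩_κ = b_κ ∫_{△^d} f g W_κ`. -/
def ipk {d : ℕ} (κ : Fin (d+1) → ℝ) (f g : (Fin d → ℝ) → ℝ) : ℝ :=
  bk κ * ∫ x in Splx d, f x * g x * Wk κ x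

/-- The norm `‖f‖_{κ,2}`. -/
def nrm2 {d : ℕ} (κ : Fin (d+1) → ℝ) (f : (Fin d → ℝ) → ℝ) : ℝ :=
  Real.sqrt (ipk κ f f)

/-- Membership in `V_n^d(W_κ)`: a polynomial of degree (at most) `n` orthogonal to all
polynomials of lower degree. -/
def InVn (d n : ℕ) (κ : Fin (d+1) → ℝ) (f : MvPolynomial (Fin d) ℝ) : Prop :=
  f.totalDegree ≤ n ∧ ∀ g : MvPolynomial (Fin d) ℝ, g.totalDegree < n →
    ipk κ (fun x => MvPolynomial.eval x f) (fun x => MvPolynomial.eval x g) = 0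

/-- `x_k` for `1 ≤ k ≤ d+1`, with the convention `x_{d+1} = 1 - |x|`. -/
def xe {d : ℕ} (x : Fin d → ℝ) (k : Fin (d+1)) : ℝ :=
  if h : (k : ℕ) < d then x ⟨(k : ℕ), h⟩ else 1 - ∑ i, x i

/-- The density of the Gamma function integral, extended by zero to negative reals. -/
def gammaDensity (a t : ℝ) : ℝ := (Set.Ici (0 : ℝ)).indicator (fun t => Real.exp (-t) * t ^ a) t

lemma gammaDensity_nonneg (a t : ℝ) : 0 ≤ gammaDensity a t := by
  refine Set.indicator_nonneg (fun t ht => ?_) t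
  have : (0 : ℝ) ≤ t := ht
  positivity

lemma gammaDensity_of_nonneg (a : ℝ) {t : ℝ} (ht : 0 ≤ t) :
    gammaDensity a t = Real.exp (-t) * t ^ a :=
  Set.indicator_of_mem (s := Set.Ici 0) ht _

lemma gammaDensity_of_neg (a : ℝ) {t : ℝ} (ht : t < 0) : gammaDensity a t = 0 :=
  Set.indicator_of_notMem (s := Set.Ici 0) (by simpa using ht) _

lemma measurable_gammaDensity (a : ℝ) : Measurable (gammaDensity a) := by
  refine Measurable.indicator ?_ measurableSet_Ici
  fun_prop

lemma integrable_gammaDensity {a : ℝ} (ha : 0 ≤ a) : Integrable (gammaDensity a) := by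
  have h := Real.GammaIntegral_convergent (s := a + 1) (by linarith)
  simp only [add_sub_cancel_right] at h
  exact (integrable_indicator_iff measurableSet_Ici).2 ((integrableOn_Ici_iff_integrableOn_Ioi).2 h)

lemma integral_gammaDensity {a : ℝ} (ha : 0 ≤ a) : ∫ t, gammaDensity a t = Real.Gamma (a + 1) := by
  rw [Real.Gamma_eq_integral (by linarith : 0 < a + 1)]
  simp only [add_sub_cancel_right]
  rw [← integral_Ici_eq_integral_Ioi, ← integral_indicator measurableSet_Ici]
  rfl

lemma continuous_Wk {d : ℕ} {κ : Fin (d + 1) → ℝ} (hκ : ∀ i, 0 ≤ κ i) :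
    Continuous (Wk κ : (Fin d → ℝ) → ℝ) := by
  unfold Wk
  refine Continuous.mul (continuous_finsetProd _ fun i _ => ?_) ?_
  · exact (continuous_apply i).rpow_const fun _ => Or.inr (hκ _)
  · exact Continuous.rpow_const (by fun_prop) fun _ => Or.inr (hκ _)

lemma isClosed_Splx (d : ℕ) : IsClosed (Splx d) := by
  have h : Splx d = (⋂ i, {x | 0 ≤ x i}) ∩ {x | ∑ i, x i ≤ 1} := by
    ext x
    simp [Splx]
  rw [h]
  exact (isClosed_iInter fun i => isClosed_le continuous_const (continuous_apply i)).inter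
    (isClosed_le (by fun_prop) continuous_const)

lemma isCompact_Splx (d : ℕ) : IsCompact (Splx d) := by
  refine (isCompact_Icc (a := (0 : Fin d → ℝ)) (b := 1)).of_isClosed_subset (isClosed_Splx d) ?_
  rintro x ⟨h0, h1⟩
  exact ⟨h0, fun i => (Finset.single_le_sum (fun j _ => h0 j) (mem_univ i)).trans h1⟩

lemma measurableSet_Splx (d : ℕ) : MeasurableSet (Splx d) := (isClosed_Splx d).measurableSet

lemma prod_gammaDensity_smul {d : ℕ} (κ : Fin (d + 1) → ℝ) {r : ℝ} (hr : 0 < r) (x : Fin d → ℝ) :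
    (∏ i, gammaDensity (κ i.castSucc) ((r • x) i)) *
        gammaDensity (κ (Fin.last d)) (r - ∑ i, (r • x) i) =
      Real.exp (-r) * r ^ (∑ i, κ i) * (Splx d).indicator (Wk κ) x := by
  have hsum : r - ∑ i, (r • x) i = r * (1 - ∑ i, x i) := by
    simp [mul_sub, Finset.mul_sum]
  rw [hsum]
  by_cases hx : x ∈ Splx d
  · rw [Set.indicator_of_mem hx]
    obtain ⟨h0, h1⟩ := hx
    have h1' : 0 ≤ 1 - ∑ i, x i := by linarith
    have e1 : ∀ i, gammaDensity (κ i.castSucc) ((r • x) i) =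
        Real.exp (-(r * x i)) * (r ^ κ i.castSucc * x i ^ κ i.castSucc) := fun i => by
      rw [Pi.smul_apply, smul_eq_mul, gammaDensity_of_nonneg _ (mul_nonneg hr.le (h0 i)),
        Real.mul_rpow hr.le (h0 i)]
    simp_rw [e1]
    rw [gammaDensity_of_nonneg _ (mul_nonneg hr.le h1'),
      Real.mul_rpow hr.le h1', Wk, Finset.prod_mul_distrib, Finset.prod_mul_distrib,
      ← Real.exp_sum, Fin.sum_univ_castSucc, Real.rpow_add hr, Real.rpow_sum_of_pos hr]
    have : Real.exp (-r) = Real.exp (∑ i, -(r * x i)) * Real.exp (-(r * (1 - ∑ i, x i))) := by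
      rw [← Real.exp_add, Finset.sum_neg_distrib, ← Finset.mul_sum]
      congr 1
      ring
    rw [this]
    ring
  · rw [Set.indicator_of_notMem hx, mul_zero]
    by_cases h0 : ∀ i, 0 ≤ x i
    · have h1 : ¬ ∑ i, x i ≤ 1 := fun h1 => hx ⟨h0, h1⟩
      rw [gammaDensity_of_neg _ (by nlinarith), mul_zero]
    · push Not at h0
      obtain ⟨i, hi⟩ := h0
      have hi' : (r • x) i < 0 := mul_neg_of_pos_of_neg hr hi
      rw [Finset.prod_eq_zero (mem_univ i) (gammaDensity_of_neg _ hi'), zero_mul]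

lemma integral_prod_gammaDensity {d : ℕ} (κ : Fin (d + 1) → ℝ) {r : ℝ} (hr : r ≠ 0) :
    ∫ x : Fin d → ℝ, (∏ i, gammaDensity (κ i.castSucc) (x i)) *
        gammaDensity (κ (Fin.last d)) (r - ∑ i, x i) =
      gammaDensity (∑ i, κ i + d) r * ∫ x in Splx d, Wk κ x := by
  rcases hr.lt_or_gt with hr | hr
  · rw [gammaDensity_of_neg _ hr, zero_mul]
    refine integral_eq_zero_of_ae (.of_forall fun x => ?_)
    by_cases h0 : ∀ i, 0 ≤ x i
    · have : 0 ≤ ∑ i, x i := Finset.sum_nonneg fun i _ => h0 i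
      simp only [Pi.zero_apply]
      rw [gammaDensity_of_neg _ (by linarith), mul_zero]
    · push Not at h0
      obtain ⟨i, hi⟩ := h0
      simp only [Pi.zero_apply]
      rw [Finset.prod_eq_zero (mem_univ i) (gammaDensity_of_neg _ hi), zero_mul]
  · have h := Measure.integral_comp_smul volume (fun x : Fin d → ℝ =>
      (∏ i, gammaDensity (κ i.castSucc) (x i)) *
        gammaDensity (κ (Fin.last d)) (r - ∑ i, x i)) r
    simp_rw [prod_gammaDensity_smul κ hr, integral_const_mul,
      integral_indicator (measurableSet_Splx d)] at h
    have hpos : 0 < r ^ d := by positivity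
    rw [Module.finrank_fintype_fun_eq_card, Fintype.card_fin, abs_of_pos (by positivity),
      smul_eq_mul] at h
    rw [gammaDensity_of_nonneg _ hr.le, Real.rpow_add hr,
      Real.rpow_natCast]
    have h2 := congrArg (fun t => r ^ d * t) h
    simp only [mul_inv_cancel_left₀ hpos.ne'] at h2
    rw [← h2]
    ring

/-- The Dirichlet integral over the simplex. -/
lemma integral_Wk {d : ℕ} {κ : Fin (d + 1) → ℝ} (hκ : ∀ i, 0 ≤ κ i) :
    Real.Gamma (∑ i, κ i + d + 1) * ∫ x in Splx d, Wk κ x = ∏ i, Real.Gamma (κ i + 1) := by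
  set G : (Fin d → ℝ) → ℝ → ℝ := fun x r => (∏ i, gammaDensity (κ i.castSucc) (x i)) *
        gammaDensity (κ (Fin.last d)) (r - ∑ i, x i) with hG
  have hGx : ∀ x, ∫ r, G x r =
      (∏ i, gammaDensity (κ i.castSucc) (x i)) * Real.Gamma (κ (Fin.last d) + 1) := fun x => by
    simp only [hG]
    rw [integral_const_mul, integral_sub_right_eq_self (gammaDensity (κ (Fin.last d))),
      integral_gammaDensity (hκ _)]
  have hGnn : ∀ x r, 0 ≤ G x r := fun x r =>
    mul_nonneg (Finset.prod_nonneg fun i _ => gammaDensity_nonneg _ _) (gammaDensity_nonneg _ _)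
  have hmeas : Measurable (Function.uncurry G) := by
    refine Measurable.mul (Finset.measurable_prod _ fun i _ => ?_) ?_
    · exact (measurable_gammaDensity _).comp (by fun_prop)
    · exact (measurable_gammaDensity _).comp (by fun_prop)
  have hG_int : Integrable (Function.uncurry G) (volume.prod volume) := by
    rw [integrable_prod_iff hmeas.aestronglyMeasurable]
    refine ⟨.of_forall fun x => ?_, ?_⟩
    · exact ((integrable_gammaDensity (hκ (Fin.last d))).comp_sub_right (∑ i, x i)).const_mul
        (∏ i, gammaDensity (κ (Fin.castSucc i)) (x i))
    · simp only [Function.uncurry_apply_pair, Real.norm_of_nonneg (hGnn _ _), hGx]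
      refine Integrable.mul_const ?_ _
      exact Integrable.fintype_prod fun i => integrable_gammaDensity (hκ _)
  have hswap := integral_integral_swap hG_int
  have hae : ∀ᵐ r : ℝ, r ≠ 0 := by simp [ae_iff]
  rw [integral_congr_ae (hae.mono fun r hr => integral_prod_gammaDensity κ hr)] at hswap
  simp_rw [hGx] at hswap
  rw [integral_mul_const, integral_mul_const, integral_gammaDensity
    (add_nonneg (Finset.sum_nonneg fun i _ => hκ i) (Nat.cast_nonneg d)),
    integral_fintype_prod_volume_eq_prod (fun i => gammaDensity (κ (Fin.castSucc i)))] at hswap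
  simp_rw [integral_gammaDensity (hκ _)] at hswap
  rw [← hswap, Fin.prod_univ_castSucc]

section SelfAdjoint

variable {V : Type*} [AddCommGroup V] [Module ℝ V] {D : V →ₗ[ℝ] V} {G : ℕ → Submodule ℝ V}
  {ev : ℕ → ℝ}

lemma exists_shifted_preimage (h0 : G 0 = ⊥) (hG : ∀ k, G k ≤ G (k + 1))
    (hD : ∀ k, ∀ f ∈ G (k + 1), D f + ev k • f ∈ G k) {c : ℝ} :
    ∀ k, (∀ j < k, ev j ≠ c) → ∀ r ∈ G k, ∃ s ∈ G k, D s + c • s = r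
  | 0, _, r, hr => ⟨0, zero_mem _, by
      rw [h0, Submodule.mem_bot] at hr
      simp [hr]⟩
  | k + 1, hc, r, hr => by
    obtain ⟨s, hs, hs'⟩ := exists_shifted_preimage h0 hG hD k
      (fun j hj => hc j (hj.trans k.lt_succ_self)) _ (hD k r hr)
    have hne : c - ev k ≠ 0 := sub_ne_zero.2 (hc k k.lt_succ_self).symm
    refine ⟨(c - ev k)⁻¹ • (r - s), Submodule.smul_mem _ _ (sub_mem hr (hG k hs)), ?_⟩
    have : (D r + c • r) - (D s + c • s) = (c - ev k) • r := by
      rw [hs']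
      module
    rw [map_smul, map_sub, smul_comm c, ← smul_add]
    have h2 : D r - D s + c • (r - s) = (c - ev k) • r := by
      rw [← this]
      module
    rw [h2, inv_smul_smul₀ hne]

lemma exists_eigenvector_add (h0 : G 0 = ⊥) (hG : ∀ k, G k ≤ G (k + 1))
    (hD : ∀ k, ∀ f ∈ G (k + 1), D f + ev k • f ∈ G k) (hev : StrictMono ev) {n : ℕ} {f : V}
    (hf : f ∈ G (n + 1)) : ∃ g ∈ G n, D (f - g) = -(ev n • (f - g)) := by
  obtain ⟨s, hs, hs'⟩ := exists_shifted_preimage h0 hG hD n (fun j hj => (hev hj).ne) _ (hD n f hf)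
  refine ⟨s, hs, ?_⟩
  rw [map_sub, eq_sub_of_add_eq hs']
  module

lemma neg_form_le_of_triangular {B : V →ₗ[ℝ] V →ₗ[ℝ] ℝ} (hB : ∀ f g, B f g = B g f)
    (hpos : ∀ f, 0 ≤ B f f) (hsa : ∀ f g, B f (D g) = B g (D f))
    (h0 : G 0 = ⊥) (hG : ∀ k, G k ≤ G (k + 1))
    (hD : ∀ k, ∀ f ∈ G (k + 1), D f + ev k • f ∈ G k) (hev : StrictMono ev) :
    ∀ (k : ℕ) {c : ℝ}, (∀ j < k, ev j ≤ c) → ∀ f ∈ G k, -B f (D f) ≤ c * B f f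
  | 0, c, _, f, hf => by
      rw [h0, Submodule.mem_bot] at hf
      simp [hf]
  | k + 1, c, hc, f, hf => by
    obtain ⟨g, hg, hh⟩ := exists_eigenvector_add h0 hG hD hev hf
    have ih := neg_form_le_of_triangular hB hpos hsa h0 hG hD hev k
      (fun j hj => hc j (hj.trans k.lt_succ_self)) g hg
    obtain ⟨h, rfl⟩ : ∃ h, f = g + h := ⟨f - g, by abel⟩
    rw [add_sub_cancel_left] at hh
    have hort : B h g = 0 := by
      obtain ⟨s, -, rfl⟩ := exists_shifted_preimage h0 hG hD k (fun j hj => (hev hj).ne) g hg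
      rw [map_add, hsa, hh, map_smul, map_neg, map_smul, hB s h]
      simp
    have h1 : B h (D h) = -(ev k * B h h) := by simp [hh]
    have h2 : B g (D h) = 0 := by simp [hh, hB g h, hort]
    have h3 : B h (D g) = 0 := by rw [hsa, h2]
    have h4 : ev k * B h h ≤ c * B h h :=
      mul_le_mul_of_nonneg_right (hc k k.lt_succ_self) (hpos h)
    simp only [map_add, LinearMap.add_apply, h1, h2, h3, hort, hB g h]
    linarith

end SelfAdjoint

open MvPolynomial

lemma integral_Wk_add_single {d : ℕ} {κ : Fin (d + 1) → ℝ} (hκ : ∀ i, 0 ≤ κ i) (j : Fin (d + 1)) :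
    (∑ i, κ i + d + 1) * ∫ x in Splx d, Wk (κ + Pi.single j 1) x =
      (κ j + 1) * ∫ x in Splx d, Wk κ x := by
  have hκ' : ∀ i, 0 ≤ (κ + Pi.single j 1 : Fin (d + 1) → ℝ) i := fun i =>
    add_nonneg (hκ i) (by by_cases h : i = j <;> simp [h])
  have hs : 0 < ∑ i, κ i + d + 1 := by
    have := Finset.sum_nonneg fun i (_ : i ∈ univ) => hκ i
    positivity
  have h1 := integral_Wk hκ
  have h2 := integral_Wk hκ'
  have hsum : ∑ i, (κ + Pi.single j 1 : Fin (d + 1) → ℝ) i + d + 1 = (∑ i, κ i + d + 1) + 1 := by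
    simp [Finset.sum_add_distrib]
    ring
  have hprod : ∏ i, Real.Gamma ((κ + Pi.single j 1 : Fin (d + 1) → ℝ) i + 1) =
      (κ j + 1) * ∏ i, Real.Gamma (κ i + 1) := by
    rw [← Finset.mul_prod_erase univ _ (mem_univ j),
      ← Finset.mul_prod_erase univ (fun i => Real.Gamma (κ i + 1)) (mem_univ j), ← mul_assoc,
      ← Real.Gamma_add_one (by linarith [hκ j])]
    congr 1
    · simp
    · refine Finset.prod_congr rfl fun i hi => ?_
      simp [Finset.ne_of_mem_erase hi]
  rw [hsum, Real.Gamma_add_one hs.ne', hprod, ← h1] at h2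
  refine mul_left_cancel₀ (Real.Gamma_pos_of_pos hs).ne' ?_
  linarith

lemma integrableOn_eval_mul_Wk {d : ℕ} {κ : Fin (d + 1) → ℝ} (hκ : ∀ i, 0 ≤ κ i)
    (p : MvPolynomial (Fin d) ℝ) : IntegrableOn (fun x => eval x p * Wk κ x) (Splx d) :=
  ((MvPolynomial.continuous_eval p).mul (continuous_Wk hκ)).continuousOn.integrableOn_compact
    (isCompact_Splx d)

/-- Integration of polynomials against the Jacobi weight on the simplex. -/
def jacobiIntegral {d : ℕ} {κ : Fin (d + 1) → ℝ} (hκ : ∀ i, 0 ≤ κ i) :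
    MvPolynomial (Fin d) ℝ →ₗ[ℝ] ℝ where
  toFun p := ∫ x in Splx d, eval x p * Wk κ x
  map_add' p q := by
    rw [← integral_add (integrableOn_eval_mul_Wk hκ p) (integrableOn_eval_mul_Wk hκ q)]
    simp only [map_add, add_mul]
  map_smul' c p := by
    simp only [smul_eval, mul_assoc, integral_const_mul, RingHom.id_apply, smul_eq_mul]

lemma jacobiIntegral_apply {d : ℕ} {κ : Fin (d + 1) → ℝ} (hκ : ∀ i, 0 ≤ κ i)
    (p : MvPolynomial (Fin d) ℝ) :
    jacobiIntegral hκ p = ∫ x in Splx d, eval x p * Wk κ x := rfl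

lemma jacobiIntegral_monomial {d : ℕ} {κ : Fin (d + 1) → ℝ} (hκ : ∀ i, 0 ≤ κ i)
    (m : Fin d →₀ ℕ) :
    jacobiIntegral hκ (monomial m 1) =
      ∫ x in Splx d, Wk (κ + Fin.snoc (α := fun _ => ℝ) (fun i => (m i : ℝ)) 0) x := by
  rw [jacobiIntegral_apply]
  refine setIntegral_congr_fun (measurableSet_Splx d) fun x hx => ?_
  simp only [Wk, eval_monomial, one_mul, Pi.add_apply, Fin.snoc_castSucc, Fin.snoc_last, add_zero]
  rw [Finsupp.prod_fintype _ _ (by simp), ← mul_assoc, ← Finset.prod_mul_distrib]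
  congr 1
  refine Finset.prod_congr rfl fun i _ => ?_
  rw [Real.rpow_add_of_nonneg (hx.1 i) (hκ _) (Nat.cast_nonneg _), Real.rpow_natCast, mul_comm]

lemma jacobiIntegral_X_mul_monomial {d : ℕ} {κ : Fin (d + 1) → ℝ} (hκ : ∀ i, 0 ≤ κ i)
    (m : Fin d →₀ ℕ) (i : Fin d) :
    (∑ j, κ j + m.degree + d + 1) * jacobiIntegral hκ (X i * monomial m 1) =
      (κ i.castSucc + m i + 1) * jacobiIntegral hκ (monomial m 1) := by
  have hX : (X i * monomial m 1 : MvPolynomial (Fin d) ℝ) = monomial (m + Finsupp.single i 1) 1 := by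
    rw [X, monomial_mul, add_comm, one_mul]
  rw [hX, jacobiIntegral_monomial, jacobiIntegral_monomial]
  have h := integral_Wk_add_single
    (κ := κ + Fin.snoc (α := fun _ => ℝ) (fun i => (m i : ℝ)) 0) (fun j => ?_) i.castSucc
  · have e : (κ + Fin.snoc (α := fun _ => ℝ) (fun j => ((m + Finsupp.single i 1 : Fin d →₀ ℕ) j : ℝ)) 0) =
        κ + Fin.snoc (α := fun _ => ℝ) (fun i => (m i : ℝ)) 0 + Pi.single i.castSucc 1 := by
      funext j
      refine Fin.lastCases ?_ (fun j => ?_) j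
      · simp [(Fin.castSucc_lt_last i).ne']
      · simp [Pi.single_apply, Finsupp.single_apply, eq_comm, add_assoc]
    rw [e]
    simpa [Finset.sum_add_distrib, Fin.sum_univ_castSucc, Finsupp.degree_eq_sum] using h
  · refine Fin.lastCases ?_ (fun j => ?_) j
    · simp [hκ]
    · simpa using add_nonneg (hκ j.castSucc) (Nat.cast_nonneg _)

/-- The Euler derivation `⟨x,∇⟩` on polynomials. -/
def eulerDerivation (d : ℕ) : Derivation ℝ (MvPolynomial (Fin d) ℝ) (MvPolynomial (Fin d) ℝ) :=
  mkDerivation ℝ X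

lemma eulerDerivation_X {d : ℕ} (i : Fin d) : eulerDerivation d (X i) = X i :=
  mkDerivation_X ..

lemma eulerDerivation_eq_sum {d : ℕ} (p : MvPolynomial (Fin d) ℝ) :
    eulerDerivation d p = ∑ i, X i * pderiv i p := by
  induction p using MvPolynomial.induction_on with
  | C a => simp [eulerDerivation]
  | add p q hp hq => simp [hp, hq, mul_add, Finset.sum_add_distrib]
  | mul_X p j hp =>
    simp only [Derivation.leibniz, eulerDerivation_X, hp, smul_eq_mul, mul_add,
      Finset.sum_add_distrib, pderiv_X, Finset.mul_sum]
    congr 1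
    · simp [Pi.single_apply, mul_comm]
    · exact Finset.sum_congr rfl fun i _ => by ring

lemma eulerDerivation_monomial {d : ℕ} (m : Fin d →₀ ℕ) :
    eulerDerivation d (monomial m 1) = (m.degree : ℝ) • monomial m 1 := by
  rw [eulerDerivation_eq_sum]
  simp_rw [X_mul_pderiv_monomial]
  rw [← Finset.sum_smul, ← Finsupp.degree_eq_sum, Nat.cast_smul_eq_nsmul]

lemma jacobiIntegral_divergence {d : ℕ} {κ : Fin (d + 1) → ℝ} (hκ : ∀ i, 0 ≤ κ i)
    (p : MvPolynomial (Fin d) ℝ) (i : Fin d) :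
    jacobiIntegral hκ (X i * pderiv i p - X i * eulerDerivation d p + (κ i.castSucc + 1) • p -
      (∑ j, κ j + d + 1) • (X i * p)) = 0 := by
  induction p using MvPolynomial.induction_on' with
  | monomial m a =>
    have ha : monomial m a = a • (monomial m 1 : MvPolynomial (Fin d) ℝ) := by
      simp [smul_monomial]
    rw [ha, Derivation.map_smul, Derivation.map_smul, eulerDerivation_monomial, mul_smul_comm, X_mul_pderiv_monomial,
      ← Nat.cast_smul_eq_nsmul ℝ]
    have h := jacobiIntegral_X_mul_monomial hκ m i
    simp only [map_sub, map_add, map_smul, mul_smul_comm, smul_eq_mul]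
    linear_combination (-a) * h
  | add p q hp hq =>
    rw [← add_zero (0 : ℝ), ← hp.trans rfl]
    nth_rewrite 2 [hp]
    rw [← hq, ← map_add]
    congr 1
    simp only [map_add, mul_add, smul_add]
    abel

/-- The second order operator on polynomials whose eigenfunctions are the orthogonal polynomials
for the Jacobi weight on the simplex. -/
def jacobiOperator {d : ℕ} (κ : Fin (d + 1) → ℝ) :
    MvPolynomial (Fin d) ℝ →ₗ[ℝ] MvPolynomial (Fin d) ℝ where
  toFun f := ∑ i : Fin d, (X i * pderiv i (pderiv i f) + (κ i.castSucc + 1) • pderiv i f) -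
    eulerDerivation d (eulerDerivation d f) - (∑ j, κ j + d) • eulerDerivation d f
  map_add' f g := by
    simp only [map_add, mul_add, smul_add, Finset.sum_add_distrib]
    abel
  map_smul' c f := by
    simp only [Derivation.map_smul, RingHom.id_apply, mul_smul_comm, smul_sub, Finset.smul_sum, smul_add,
      smul_comm c]

lemma jacobiOperator_apply {d : ℕ} (κ : Fin (d + 1) → ℝ) (f : MvPolynomial (Fin d) ℝ) :
    jacobiOperator κ f =
      ∑ i : Fin d, (X i * pderiv i (pderiv i f) + (κ i.castSucc + 1) • pderiv i f) -
        eulerDerivation d (eulerDerivation d f) - (∑ j, κ j + d) • eulerDerivation d f := rfl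

/-- The carré du champ of `jacobiOperator`. -/
def simplexCarre {d : ℕ} (f g : MvPolynomial (Fin d) ℝ) : MvPolynomial (Fin d) ℝ :=
  ∑ i, X i * pderiv i f * pderiv i g - eulerDerivation d f * eulerDerivation d g

lemma simplexCarre_comm {d : ℕ} (f g : MvPolynomial (Fin d) ℝ) :
    simplexCarre f g = simplexCarre g f := by
  simp only [simplexCarre, mul_comm, mul_left_comm]

lemma jacobiIntegral_mul_jacobiOperator {d : ℕ} {κ : Fin (d + 1) → ℝ} (hκ : ∀ i, 0 ≤ κ i)
    (f g : MvPolynomial (Fin d) ℝ) :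
    jacobiIntegral hκ (g * jacobiOperator κ f) = -jacobiIntegral hκ (simplexCarre g f) := by
  have h : ∑ i, jacobiIntegral hκ (X i * pderiv i (g * pderiv i f) -
      X i * eulerDerivation d (g * pderiv i f) + (κ i.castSucc + 1) • (g * pderiv i f) -
      (∑ j, κ j + d + 1) • (X i * (g * pderiv i f))) = 0 :=
    Finset.sum_eq_zero fun i _ => jacobiIntegral_divergence hκ _ i
  rw [← map_sum] at h
  rw [eq_neg_iff_add_eq_zero, ← map_add, ← h]
  congr 1
  have hE : ∑ i, X i * eulerDerivation d (g * pderiv i f) =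
      eulerDerivation d (g * eulerDerivation d f) - g * eulerDerivation d f := by
    have h1 : g * eulerDerivation d f = ∑ i, X i * (g * pderiv i f) := by
      rw [eulerDerivation_eq_sum, Finset.mul_sum]
      exact Finset.sum_congr rfl fun i _ => by ring
    rw [h1, map_sum, ← Finset.sum_sub_distrib]
    refine Finset.sum_congr rfl fun i _ => ?_
    rw [Derivation.leibniz (eulerDerivation d) (X i), eulerDerivation_X]
    simp only [smul_eq_mul]
    ring
  have hE2 : ∑ i, (∑ j, κ j + d + 1) • (X i * (g * pderiv i f)) =
      (∑ j, κ j + d + 1) • (g * eulerDerivation d f) := by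
    rw [eulerDerivation_eq_sum, Finset.mul_sum, Finset.smul_sum]
    exact Finset.sum_congr rfl fun i _ => by rw [mul_left_comm]
  rw [Finset.sum_sub_distrib, Finset.sum_add_distrib, Finset.sum_sub_distrib, hE, hE2,
    jacobiOperator_apply, simplexCarre, Derivation.leibniz]
  simp only [Derivation.leibniz, smul_eq_mul, mul_sub, mul_add, Finset.sum_add_distrib,
    Finset.mul_sum, mul_smul_comm, add_smul, one_smul]
  have e1 : ∑ i, X i * (g * pderiv i (pderiv i f)) = ∑ i, g * (X i * pderiv i (pderiv i f)) :=
    Finset.sum_congr rfl fun i _ => by ring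
  have e2 : ∑ i, X i * (pderiv i f * pderiv i g) = ∑ i, X i * pderiv i g * pderiv i f :=
    Finset.sum_congr rfl fun i _ => by ring
  rw [e1, e2]
  ring

/-- The negatives of the eigenvalues of `jacobiOperator`. -/
def jacobiEigenvalue {d : ℕ} (κ : Fin (d + 1) → ℝ) (n : ℕ) : ℝ := n * (n + ∑ k, κ k + d)

lemma strictMono_jacobiEigenvalue {d : ℕ} (hd : 0 < d) {κ : Fin (d + 1) → ℝ}
    (hκ : ∀ i, 0 ≤ κ i) : StrictMono (jacobiEigenvalue κ) := by
  refine strictMono_nat_of_lt_succ fun n => ?_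
  have h1 := Finset.sum_nonneg fun i (_ : i ∈ univ) => hκ i
  have h2 : (0 : ℝ) < d := Nat.cast_pos.2 hd
  have h3 : (0 : ℝ) ≤ n := Nat.cast_nonneg n
  simp only [jacobiEigenvalue]
  push_cast
  nlinarith

/-- Polynomials of degree less than `k` all of whose exponents lie in `S`. -/
def supportedDegreeLT {d : ℕ} (S : Set (Fin d →₀ ℕ)) (k : ℕ) :
    Submodule ℝ (MvPolynomial (Fin d) ℝ) :=
  restrictSupport ℝ {m | m ∈ S ∧ m.degree < k}

lemma supportedDegreeLT_zero {d : ℕ} (S : Set (Fin d →₀ ℕ)) : supportedDegreeLT S 0 = ⊥ := by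
  simp [supportedDegreeLT, restrictSupport_eq_span]

lemma supportedDegreeLT_le_succ {d : ℕ} (S : Set (Fin d →₀ ℕ)) (k : ℕ) :
    supportedDegreeLT S k ≤ supportedDegreeLT S (k + 1) :=
  restrictSupport_mono _ fun _ hm => ⟨hm.1, hm.2.trans k.lt_succ_self⟩

lemma jacobiOperator_monomial {d : ℕ} (κ : Fin (d + 1) → ℝ) (m : Fin d →₀ ℕ) :
    jacobiOperator κ (monomial m 1) + jacobiEigenvalue κ m.degree • monomial m 1 =
      ∑ i, monomial (m - Finsupp.single i 1) ((m i : ℝ) * (m i + κ i.castSucc)) := by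
  have hi : ∀ i, X i * pderiv i (pderiv i (monomial m 1)) +
      (κ i.castSucc + 1) • pderiv i (monomial m (1 : ℝ)) =
        monomial (m - Finsupp.single i 1) ((m i : ℝ) * (m i + κ i.castSucc)) := fun i => by
    rw [pderiv_monomial, X_mul_pderiv_monomial, smul_monomial, smul_monomial, ← map_add]
    congr 1
    rcases Nat.eq_zero_or_pos (m i) with h | h
    · simp [h]
    · simp only [Finsupp.tsub_apply, Finsupp.single_eq_same, nsmul_eq_mul, smul_eq_mul]
      rw [Nat.cast_sub h]
      push_cast
      ring
  rw [jacobiOperator_apply, Finset.sum_congr rfl fun i _ => hi i, eulerDerivation_monomial,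
    Derivation.map_smul, eulerDerivation_monomial, jacobiEigenvalue]
  module

lemma jacobiOperator_add_mem {d : ℕ} (κ : Fin (d + 1) → ℝ) {S : Set (Fin d →₀ ℕ)}
    (hS : IsLowerSet S) (k : ℕ) (f : MvPolynomial (Fin d) ℝ) (hf : f ∈ supportedDegreeLT S (k + 1)) :
    jacobiOperator κ f + jacobiEigenvalue κ k • f ∈ supportedDegreeLT S k := by
  rw [supportedDegreeLT, restrictSupport_eq_span] at hf
  induction hf using Submodule.span_induction with
  | mem f hf =>
    obtain ⟨m, ⟨hmS, hm⟩, rfl⟩ := hf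
    have hlow : ∑ i, monomial (m - Finsupp.single i 1) ((m i : ℝ) * (m i + κ i.castSucc)) ∈
        supportedDegreeLT S k := by
      refine Submodule.sum_mem _ fun i _ => ?_
      rw [supportedDegreeLT, monomial_mem_restrictSupport]
      rcases Nat.eq_zero_or_pos (m i) with h | h
      · simp [h]
      · refine Or.inl ⟨hS tsub_le_self hmS, ?_⟩
        have := congrArg Finsupp.degree (Finsupp.sub_add_single_one_cancel h.ne')
        rw [map_add, Finsupp.degree_single] at this
        omega
    rw [← jacobiOperator_monomial] at hlow
    rcases (Nat.lt_succ_iff.1 hm).eq_or_lt with h | h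
    · rwa [h] at hlow
    · have hmem : (monomial m 1 : MvPolynomial (Fin d) ℝ) ∈ supportedDegreeLT S k := by
        rw [supportedDegreeLT, monomial_mem_restrictSupport]
        exact Or.inl ⟨hmS, h⟩
      have h2 := add_mem hlow (Submodule.smul_mem _
        (jacobiEigenvalue κ k - jacobiEigenvalue κ m.degree) hmem)
      convert h2 using 1
      module
  | zero => simp
  | add f g _ _ hf hg =>
    have := add_mem hf hg
    rw [map_add]
    convert this using 1
    module
  | smul c f _ hf =>
    have := Submodule.smul_mem _ c hf
    rw [map_smul]
    convert this using 1
    module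

lemma Wk_nonneg {d : ℕ} (κ : Fin (d + 1) → ℝ) {x : Fin d → ℝ} (hx : x ∈ Splx d) : 0 ≤ Wk κ x :=
  mul_nonneg (Finset.prod_nonneg fun i _ => Real.rpow_nonneg (hx.1 i) _)
    (Real.rpow_nonneg (sub_nonneg.2 hx.2) _)

lemma jacobiIntegral_carre_le {d : ℕ} (hd : 0 < d) {κ : Fin (d + 1) → ℝ} (hκ : ∀ i, 0 ≤ κ i)
    {n : ℕ} {f : MvPolynomial (Fin d) ℝ} (hf : f.totalDegree ≤ n) :
    jacobiIntegral hκ (simplexCarre f f) ≤ jacobiEigenvalue κ n * jacobiIntegral hκ (f * f) := by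
  have hev := strictMono_jacobiEigenvalue hd hκ
  have h := neg_form_le_of_triangular (D := jacobiOperator κ) (ev := jacobiEigenvalue κ)
    (G := supportedDegreeLT Set.univ) (B := (LinearMap.mul ℝ _).compr₂ (jacobiIntegral hκ))
    (fun f g => by simp [mul_comm]) (fun f => ?_) (fun f g => ?_) (supportedDegreeLT_zero _)
    (supportedDegreeLT_le_succ _) (jacobiOperator_add_mem κ isLowerSet_univ) hev (n + 1)
    (c := jacobiEigenvalue κ n) (fun j hj => hev.monotone (Nat.lt_succ_iff.1 hj)) f
    (fun m hm => ⟨trivial, Nat.lt_succ_iff.2 ((le_totalDegree hm).trans hf)⟩)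
  · simpa [jacobiIntegral_mul_jacobiOperator] using h
  · rw [LinearMap.compr₂_apply, LinearMap.mul_apply', jacobiIntegral_apply]
    refine setIntegral_nonneg (measurableSet_Splx d) fun x hx => ?_
    rw [map_mul]
    exact mul_nonneg (mul_self_nonneg _) (Wk_nonneg κ hx)
  · simp [jacobiIntegral_mul_jacobiOperator, simplexCarre_comm f g]

lemma exists_univariate_eigenfunction {d : ℕ} (hd : 0 < d) {κ : Fin (d + 1) → ℝ}
    (hκ : ∀ i, 0 ≤ κ i) (n : ℕ) (l : Fin d) :
    ∃ f : MvPolynomial (Fin d) ℝ, f ≠ 0 ∧ f.totalDegree = n ∧ (∀ i ≠ l, pderiv i f = 0) ∧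
      jacobiOperator κ f = -(jacobiEigenvalue κ n • f) := by
  set S : Set (Fin d →₀ ℕ) := {m | ∀ i ≠ l, m i = 0} with hS
  have hSl : IsLowerSet S := fun a b hab ha i hi => Nat.le_zero.1 ((hab i).trans_eq (ha i hi))
  have hX : (monomial (Finsupp.single l n) 1 : MvPolynomial (Fin d) ℝ) ∈
      supportedDegreeLT S (n + 1) := by
    rw [supportedDegreeLT, monomial_mem_restrictSupport]
    refine Or.inl ⟨fun i hi => by simp [hi.symm], by simp⟩
  obtain ⟨g, hg, hgD⟩ := exists_eigenvector_add (supportedDegreeLT_zero S)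
    (supportedDegreeLT_le_succ S) (jacobiOperator_add_mem κ hSl)
    (strictMono_jacobiEigenvalue hd hκ) hX
  have hmem := sub_mem hX (supportedDegreeLT_le_succ S n hg)
  have hcoeff : coeff (Finsupp.single l n) (monomial (Finsupp.single l n) 1 - g) = 1 := by
    have : coeff (Finsupp.single l n) g = 0 := by
      by_contra h
      have := (hg (mem_support_iff.2 h)).2
      simp at this
    simp [this]
  refine ⟨_, fun h => by simp [h] at hcoeff, le_antisymm ?_ ?_, fun i hi => ?_, hgD⟩
  · exact Finset.sup_le fun m hm => Nat.lt_succ_iff.1 (hmem hm).2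
  · have := le_totalDegree (mem_support_iff.2 (hcoeff.trans_ne one_ne_zero))
    simpa using this
  · refine pderiv_eq_zero_of_notMem_vars fun h => ?_
    obtain ⟨m, hm, him⟩ := (mem_vars_iff_mem_support i).1 h
    exact Finsupp.mem_support_iff.1 him ((hmem hm).1 i hi)

lemma hasFDerivAt_eval {d : ℕ} (p : MvPolynomial (Fin d) ℝ) (x : Fin d → ℝ) :
    HasFDerivAt (fun y : Fin d → ℝ => eval y p)
      (∑ i, eval x (pderiv i p) • ContinuousLinearMap.proj (R := ℝ) (φ := fun _ : Fin d => ℝ) i)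
      x := by
  induction p using MvPolynomial.induction_on with
  | C a => simpa using hasFDerivAt_const a x
  | add p q hp hq =>
    simp only [map_add]
    refine (hp.add hq).congr_fderiv ?_
    simp [add_smul, Finset.sum_add_distrib]
  | mul_X p j hp =>
    have h := hp.mul (hasFDerivAt_apply (𝕜 := ℝ) j x)
    simp only [map_mul, eval_X]
    refine h.congr_fderiv ?_
    ext v
    simp [Derivation.leibniz, add_mul, Finset.sum_add_distrib, Pi.single_apply, Finset.mul_sum,
      pderiv_X, mul_assoc, apply_ite (eval x)]

lemma pd_eval {d : ℕ} (p : MvPolynomial (Fin d) ℝ) (i : Fin d) (x : Fin d → ℝ) :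
    pd i (fun y => eval y p) x = eval x (pderiv i p) := by
  rw [pd, (hasFDerivAt_eval p x).fderiv]
  simp [Pi.single_apply]

lemma xgrad_eval {d : ℕ} (p : MvPolynomial (Fin d) ℝ) (x : Fin d → ℝ) :
    xgrad (fun y => eval y p) x = eval x (eulerDerivation d p) := by
  simp [xgrad, pd_eval, eulerDerivation_eq_sum]

lemma eval_simplexCarre {d : ℕ} (p : MvPolynomial (Fin d) ℝ) (x : Fin d → ℝ) :
    eval x (simplexCarre p p) = ∑ i, x i * eval x (pderiv i p) ^ 2 -
      (∑ i, x i * eval x (pderiv i p)) ^ 2 := by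
  simp [simplexCarre, eulerDerivation_eq_sum, sq, mul_assoc]

lemma sq_radial_le {d : ℕ} {x : Fin d → ℝ} (hx : x ∈ Splx d) (l : Fin d) (g : Fin d → ℝ) :
    (√(x l) / √(1 - x l) * (∑ i, x i * g i - g l)) ^ 2 ≤
      ∑ i, x i * g i ^ 2 - (∑ i, x i * g i) ^ 2 := by
  obtain ⟨h0, h1⟩ := hx
  have hs1 : (∑ i ∈ univ.erase l, x i) + x l = ∑ i, x i := Finset.sum_erase_add _ _ (mem_univ l)
  have hs2 : (∑ i ∈ univ.erase l, x i * g i ^ 2) + x l * g l ^ 2 = ∑ i, x i * g i ^ 2 :=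
    Finset.sum_erase_add _ _ (mem_univ l)
  have hs3 : (∑ i ∈ univ.erase l, x i * g i) + x l * g l = ∑ i, x i * g i :=
    Finset.sum_erase_add _ _ (mem_univ l)
  have hcs := Finset.sum_sq_le_sum_mul_sum_of_sq_le_mul (univ.erase l) (r := fun i => x i * g i)
    (f := x) (g := fun i => x i * g i ^ 2) (fun i _ => h0 i)
    (fun i _ => mul_nonneg (h0 i) (sq_nonneg _)) (fun i _ => le_of_eq (by ring))
  have hQ : 0 ≤ ∑ i ∈ univ.erase l, x i * g i ^ 2 :=
    Finset.sum_nonneg fun i _ => mul_nonneg (h0 i) (sq_nonneg _)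
  have hR : 0 ≤ ∑ i ∈ univ.erase l, x i := Finset.sum_nonneg fun i _ => h0 i
  rw [← hs2, ← hs3]
  set T := ∑ i ∈ univ.erase l, x i * g i
  set Q := ∑ i ∈ univ.erase l, x i * g i ^ 2
  have hm : ∑ i ∈ univ.erase l, x i ≤ 1 - x l := by linarith
  have hTQ : T ^ 2 ≤ (1 - x l) * Q := hcs.trans (mul_le_mul_of_nonneg_right hm hQ)
  have hm0 : 0 ≤ 1 - x l := hR.trans hm
  rw [mul_pow, div_pow, Real.sq_sqrt (h0 l), Real.sq_sqrt hm0]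
  rcases hm0.eq_or_lt with h | h
  · have hT : T = 0 := by
      rw [← h, zero_mul] at hTQ
      exact pow_eq_zero_iff two_ne_zero |>.1 (le_antisymm hTQ (sq_nonneg _))
    have hx1 : x l = 1 := by linarith
    rw [← h, hT, hx1]
    simpa using hQ
  · have key : Q + x l * g l ^ 2 - (T + x l * g l) ^ 2 -
        x l / (1 - x l) * (T + x l * g l - g l) ^ 2 = ((1 - x l) * Q - T ^ 2) / (1 - x l) := by
      field_simp
      ring
    have := div_nonneg (sub_nonneg.2 hTQ) h.le
    linarith

lemma sq_radial_eq {d : ℕ} {x : Fin d → ℝ} (hx : x ∈ Splx d) (l : Fin d) {g : Fin d → ℝ}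
    (hg : ∀ i ≠ l, g i = 0) :
    (√(x l) / √(1 - x l) * (∑ i, x i * g i - g l)) ^ 2 =
      ∑ i, x i * g i ^ 2 - (∑ i, x i * g i) ^ 2 := by
  have hx1 : x l ≤ 1 := (Finset.single_le_sum (fun j _ => hx.1 j) (mem_univ l)).trans hx.2
  rw [Finset.sum_eq_single l (fun i _ hi => by simp [hg i hi]) (by simp),
    Finset.sum_eq_single l (fun i _ hi => by simp [hg i hi]) (by simp),
    mul_pow, div_pow, Real.sq_sqrt (hx.1 l), Real.sq_sqrt (sub_nonneg.2 hx1)]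
  rcases hx1.eq_or_lt with h | h
  · simp [h]
  · have : 1 - x l ≠ 0 := (sub_pos.2 h).ne'
    field_simp
    ring

lemma bk_nonneg {d : ℕ} {κ : Fin (d + 1) → ℝ} (hκ : ∀ i, 0 ≤ κ i) : 0 ≤ bk κ := by
  have h := Finset.sum_nonneg fun i (_ : i ∈ univ) => hκ i
  refine div_nonneg (Real.Gamma_nonneg_of_nonneg (by positivity))
    (Finset.prod_nonneg fun i _ => Real.Gamma_nonneg_of_nonneg (by linarith [hκ i]))

/-- the sharp inequality \eqref{eq:B-ineq2a}. -/
theorem stmt14 (d : ℕ) (hd : 2 ≤ d) (κ : Fin (d+1) → ℝ) (hκ : ∀ i, 0 ≤ κ i)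
    (n : ℕ) (l : Fin d) :
    (∀ f : MvPolynomial (Fin d) ℝ, f.totalDegree ≤ n →
      nrm2 κ (fun x => Real.sqrt (x l) / Real.sqrt (1 - x l) *
          (xgrad (fun y => MvPolynomial.eval y f) x - pd l (fun y => MvPolynomial.eval y f) x)) ≤
        Real.sqrt ((n : ℝ) * ((n : ℝ) + (∑ k, κ k) + (d : ℝ))) *
          nrm2 κ (fun x => MvPolynomial.eval x f)) ∧
    (∃ f : MvPolynomial (Fin d) ℝ, f ≠ 0 ∧ f.totalDegree = n ∧
      nrm2 κ (fun x => Real.sqrt (x l) / Real.sqrt (1 - x l) *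
          (xgrad (fun y => MvPolynomial.eval y f) x - pd l (fun y => MvPolynomial.eval y f) x)) =
        Real.sqrt ((n : ℝ) * ((n : ℝ) + (∑ k, κ k) + (d : ℝ))) *
          nrm2 κ (fun x => MvPolynomial.eval x f)) := by
  have hev : (n : ℝ) * ((n : ℝ) + (∑ k, κ k) + (d : ℝ)) = jacobiEigenvalue κ n := rfl
  have hev0 : 0 ≤ jacobiEigenvalue κ n := by
    have h := Finset.sum_nonneg fun i (_ : i ∈ univ) => hκ i
    rw [← hev]
    positivity
  have hbk := bk_nonneg hκ
  simp only [hev, nrm2, ipk, ← Real.sqrt_mul hev0, mul_left_comm (jacobiEigenvalue κ n)]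
  have hr : ∀ f : MvPolynomial (Fin d) ℝ, ∫ x in Splx d, eval x f * eval x f * Wk κ x =
      jacobiIntegral hκ (f * f) := fun f => by simp [jacobiIntegral_apply]
  simp_rw [hr, xgrad_eval, pd_eval, ← sq, eulerDerivation_eq_sum, map_sum, map_mul, eval_X]
  constructor
  · intro f hf
    refine Real.sqrt_le_sqrt (mul_le_mul_of_nonneg_left ?_ hbk)
    rw [sq]
    refine le_trans ?_ (jacobiIntegral_carre_le (by omega) hκ hf)
    rw [jacobiIntegral_apply]
    refine integral_mono_of_nonneg ?_ (integrableOn_eval_mul_Wk hκ _) ?_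
    · filter_upwards [ae_restrict_mem (measurableSet_Splx d)] with x hx
      exact mul_nonneg (sq_nonneg _) (Wk_nonneg κ hx)
    · filter_upwards [ae_restrict_mem (measurableSet_Splx d)] with x hx
      rw [eval_simplexCarre]
      exact mul_le_mul_of_nonneg_right
        (sq_radial_le hx l fun i => eval x (pderiv i f)) (Wk_nonneg κ hx)
  · obtain ⟨f, hf0, hfn, hfl, hfD⟩ := exists_univariate_eigenfunction (by omega) hκ n l
    refine ⟨f, hf0, hfn, ?_⟩
    congr 2
    have h := jacobiIntegral_mul_jacobiOperator hκ f f
    rw [hfD, mul_neg, mul_smul_comm, map_neg, map_smul, neg_inj, smul_eq_mul] at h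
    rw [sq f, h, jacobiIntegral_apply]
    refine setIntegral_congr_fun (measurableSet_Splx d) fun x hx => ?_
    simp only [eval_simplexCarre]
    rw [sq_radial_eq hx l (g := fun i => eval x (pderiv i f)) fun i hi => by simp [hfl i hi]]
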